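/- Let 1 < u < ∞. There exists a constant C > 0, depending only on u, the root system R and the multiplicity function κ, such that for every b ∈ BMO_d, every x₀ ∈ ℝ^N and every r > 0: ∫_{{ξ : d(ξ,x₀) ≥ 5r}} (d(ξ,x₀) · ω(B(ξ, d(ξ,x₀))))^{−1} · |b(ξ) − b_{O(B(x₀,r))}|^{u} dω(ξ) ≤ C · r^{−1} · ‖b‖_{BMO_d}^{u}. -/

import Mathlib

open MeasureTheory Metric
open scoped ENNReal RealInnerProductSpace NNReal

noncomputable section

variable {N : ℕ}

/-- The reflection `σ_α(x) = x - ⟨α,x⟩ α` associated with a normalized root `α`. -/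
def dunklReflect (α x : EuclideanSpace ℝ (Fin N)) : EuclideanSpace ℝ (Fin N) :=
  x - ⟪α, x⟫ • α

/-- The reflection group `G` generated by the root reflections, realized as the subgroup of
linear isometries of `ℝ^N` whose generators act by the reflection formula. -/
def dunklGroup (Rs : Finset (EuclideanSpace ℝ (Fin N))) :
    Subgroup (EuclideanSpace ℝ (Fin N) ≃ₗᵢ[ℝ] EuclideanSpace ℝ (Fin N)) :=
  Subgroup.closure {σ | ∃ α ∈ Rs, ⇑σ = dunklReflect α}

/-- The Dunkl weight `h_κ(x) = ∏_{α ∈ R} |⟨α,x⟩|^{κ(α)}`. -/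
def dunklWeight (Rs : Finset (EuclideanSpace ℝ (Fin N))) (κ : EuclideanSpace ℝ (Fin N) → ℝ)
    (x : EuclideanSpace ℝ (Fin N)) : ℝ :=
  ∏ α ∈ Rs, |⟪α, x⟫| ^ κ α

/-- The Dunkl measure `dω(x) = h_κ(x) dx`. -/
def dunklMeasure (Rs : Finset (EuclideanSpace ℝ (Fin N)))
    (κ : EuclideanSpace ℝ (Fin N) → ℝ) : Measure (EuclideanSpace ℝ (Fin N)) :=
  volume.withDensity fun x => ENNReal.ofReal (dunklWeight Rs κ x)

/-- The Dunkl metric `d(x,y) = min_{σ ∈ G} ‖x - σ(y)‖`. -/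
def dunklDist (Rs : Finset (EuclideanSpace ℝ (Fin N))) (x y : EuclideanSpace ℝ (Fin N)) : ℝ :=
  ⨅ σ : dunklGroup Rs, ‖x - σ.1 y‖

/-- The Dunkl ball `O(B(x,r)) = {y : d(x,y) < r}`. -/
def dunklBall (Rs : Finset (EuclideanSpace ℝ (Fin N))) (x : EuclideanSpace ℝ (Fin N)) (r : ℝ) :
    Set (EuclideanSpace ℝ (Fin N)) :=
  {y | dunklDist Rs x y < r}

/-- M is a BMO_d bound for b: every Dunkl ball has mean oscillation at most M. -/
def IsBMOdBound (Rs : Finset (EuclideanSpace ℝ (Fin N))) (μ : Measure (EuclideanSpace ℝ (Fin N)))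
    (b : EuclideanSpace ℝ (Fin N) → ℝ) (M : ℝ) : Prop :=
  ∀ (x : EuclideanSpace ℝ (Fin N)) (r : ℝ), 0 < r →
    ⨍ y in dunklBall Rs x r, |b y - ⨍ z in dunklBall Rs x r, b z ∂μ| ∂μ ≤ M

/-- b belongs to BMO_d. -/
def MemBMOd (Rs : Finset (EuclideanSpace ℝ (Fin N))) (μ : Measure (EuclideanSpace ℝ (Fin N)))
    (b : EuclideanSpace ℝ (Fin N) → ℝ) : Prop :=
  LocallyIntegrable b μ ∧ ∃ M : ℝ, IsBMOdBound Rs μ b M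

/-- The BMO_d norm of b. -/
def bmodNorm (Rs : Finset (EuclideanSpace ℝ (Fin N))) (μ : Measure (EuclideanSpace ℝ (Fin N)))
    (b : EuclideanSpace ℝ (Fin N) → ℝ) : ℝ :=
  sInf {M | 0 ≤ M ∧ IsBMOdBound Rs μ b M}


section Averages

variable {X : Type*} [MeasurableSpace X]

lemma abs_setAverage_sub_le {μ : Measure X} {b : X → ℝ} {E F : Set X} {c K M : ℝ}
    (hEF : E ⊆ F) (hE : μ E ≠ 0) (hF : μ F ≠ ∞) (hb : IntegrableOn b F μ) (hM : 0 ≤ M)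
    (hK : μ.real F ≤ K * μ.real E) (h : ∫ y in F, |b y - c| ∂μ ≤ M * μ.real F) :
    |(⨍ y in E, b y ∂μ) - c| ≤ K * M := by
  have hEt : μ E ≠ ∞ := ne_top_of_le_ne_top hF (measure_mono hEF)
  have hE0 : 0 < μ.real E := ENNReal.toReal_pos hE hEt
  have hbE : IntegrableOn b E μ := hb.mono_set hEF
  have hcE : IntegrableOn (fun _ : X => c) E μ := integrableOn_const hEt
  have hcF : IntegrableOn (fun _ : X => c) F μ := integrableOn_const hF
  have h1 : (⨍ y in E, b y ∂μ) - c = (μ.real E)⁻¹ * ∫ y in E, (b y - c) ∂μ := by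
    rw [setAverage_eq, integral_sub hbE hcE, setIntegral_const, smul_eq_mul, smul_eq_mul]
    field_simp
  have h2 : |∫ y in E, (b y - c) ∂μ| ≤ K * M * μ.real E :=
    calc |∫ y in E, (b y - c) ∂μ| ≤ ∫ y in E, |b y - c| ∂μ := abs_integral_le_integral_abs
      _ ≤ ∫ y in F, |b y - c| ∂μ :=
        setIntegral_mono_set (hb.sub hcF).abs (Filter.Eventually.of_forall fun _ => abs_nonneg _)
          hEF.eventuallyLE
      _ ≤ M * μ.real F := h
      _ ≤ M * (K * μ.real E) := by gcongr
      _ = K * M * μ.real E := by ring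
  rw [h1, abs_mul, abs_of_pos (inv_pos.2 hE0), inv_mul_le_iff₀ hE0]
  linarith

lemma measureReal_le_mul_of_le {μ : Measure X} {E F : Set X} {K : ℝ≥0} (hE : μ E ≠ ∞)
    (h : μ F ≤ K * μ E) : μ.real F ≤ K * μ.real E := by
  have := ENNReal.toReal_mono (ENNReal.mul_ne_top ENNReal.coe_ne_top hE) h
  simpa [Measure.real, ENNReal.toReal_mul] using this

end Averages

section Doubling

variable {X : Type*} [PseudoMetricSpace X] [MeasurableSpace X]

/-- The measure of a closed ball at most gets multiplied by `D` when its radius is doubled. -/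
def DoublingWith (μ : Measure X) (D : ℝ≥0) : Prop :=
  1 ≤ D ∧ ∀ (x : X) (r : ℝ), 0 < r → μ (closedBall x (2 * r)) ≤ D * μ (closedBall x r)

lemma DoublingWith.isUnifLocDoublingMeasure {μ : Measure X} {D : ℝ≥0} (hD : DoublingWith μ D) :
    IsUnifLocDoublingMeasure μ :=
  ⟨D, by filter_upwards [self_mem_nhdsWithin] with ε hε x using hD.2 x ε hε⟩

lemma DoublingWith.measure_le_pow {μ : Measure X} {D : ℝ≥0} (hD : DoublingWith μ D)
    (x : X) {r : ℝ} (hr : 0 < r) (n : ℕ) :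
    μ (closedBall x (2 ^ n * r)) ≤ (D : ℝ≥0∞) ^ n * μ (closedBall x r) := by
  induction n with
  | zero => simp
  | succ n ih =>
    calc μ (closedBall x (2 ^ (n + 1) * r)) = μ (closedBall x (2 * (2 ^ n * r))) := by
          congr 2; ring
      _ ≤ D * μ (closedBall x (2 ^ n * r)) := hD.2 x _ (by positivity)
      _ ≤ D * ((D : ℝ≥0∞) ^ n * μ (closedBall x r)) := by gcongr
      _ = (D : ℝ≥0∞) ^ (n + 1) * μ (closedBall x r) := by ring

/-- Every closed ball has mean oscillation at most `M`. -/
def OscBound (μ : Measure X) (b : X → ℝ) (M : ℝ) : Prop :=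
  ∀ (x : X) (r : ℝ), 0 < r →
    ∫ y in closedBall x r, |b y - ⨍ z in closedBall x r, b z ∂μ| ∂μ ≤ M * μ.real (closedBall x r)

variable [ProperSpace X] [BorelSpace X] {μ : Measure X} [IsLocallyFiniteMeasure μ]
  {b : X → ℝ} {D : ℝ≥0} {M : ℝ}

lemma measure_closedBall_ne_top (x : X) (r : ℝ) : μ (closedBall x r) ≠ ∞ :=
  (isCompact_closedBall x r).measure_lt_top.ne

variable [μ.IsOpenPosMeasure]

lemma OscBound.abs_average_sub_average_le (hb : LocallyIntegrable b μ) (hM : 0 ≤ M)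
    (ho : OscBound μ b M) {x y : X} {r s : ℝ} (hr : 0 < r) (hs : 0 < s) {K : ℝ≥0}
    (hsub : closedBall x r ⊆ closedBall y s)
    (hK : μ (closedBall y s) ≤ K * μ (closedBall x r)) :
    |(⨍ z in closedBall x r, b z ∂μ) - ⨍ z in closedBall y s, b z ∂μ| ≤ K * M :=
  abs_setAverage_sub_le hsub (measure_closedBall_pos μ x hr).ne' (measure_closedBall_ne_top y s)
    (hb.integrableOn_isCompact (isCompact_closedBall y s)) hM
    (measureReal_le_mul_of_le (measure_closedBall_ne_top x r) hK) (ho y s hs)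

/-- The portion of a closed ball where `b` deviates from its average by at least `t`. -/
def deviationSet (μ : Measure X) (b : X → ℝ) (x : X) (r t : ℝ) : Set X :=
  {y ∈ closedBall x r | t ≤ |b y - ⨍ z in closedBall x r, b z ∂μ|}

/-- Stopping-time selection: a point where `b` is the limit of its averages and deviates much
from the average over the ball `closedBall x R` is the center of a ball with comparable
deviation. -/
lemma OscBound.exists_stopping_radius (hb : LocallyIntegrable b μ) (hD : DoublingWith μ D)
    (hM : 0 ≤ M) (ho : OscBound μ b M) {x y : X} {R A t : ℝ} (hR : 0 < R)
    (hA : 2 * (D : ℝ) ^ 2 ≤ A) (hy : y ∈ closedBall x R)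
    (hlim : Filter.Tendsto (fun j : ℕ => ⨍ z in closedBall y (R / 2 ^ j), b z ∂μ) Filter.atTop
      (nhds (b y)))
    (ht : A * M < t) (hyt : t ≤ |b y - ⨍ z in closedBall x R, b z ∂μ|) :
    ∃ ρ, 0 < ρ ∧ ρ ≤ R / 2 ∧
      A * M < |(⨍ z in closedBall y ρ, b z ∂μ) - ⨍ z in closedBall x R, b z ∂μ| ∧
      |(⨍ z in closedBall y (4 * ρ), b z ∂μ) - ⨍ z in closedBall x R, b z ∂μ| ≤ (A + D) * M := by
  classical
  set m := ⨍ z in closedBall x R, b z ∂μ with hm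
  have hD1 : (1 : ℝ) ≤ D := by exact_mod_cast hD.1
  have hex : ∃ j : ℕ, A * M < |(⨍ z in closedBall y (R / 2 ^ j), b z ∂μ) - m| := by
    have h1 := (hlim.sub_const m).abs
    exact (h1.eventually (lt_mem_nhds (ht.trans_le hyt))).exists
  have hdist : dist y x ≤ R := hy
  have h0 : ¬ A * M < |(⨍ z in closedBall y (R / 2 ^ 0), b z ∂μ) - m| := by
    rw [not_lt, pow_zero, div_one]
    have e1 : |(⨍ z in closedBall y R, b z ∂μ) - ⨍ z in closedBall x (2 * R), b z ∂μ|
        ≤ ((D ^ 2 : ℝ≥0) : ℝ) * M := by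
      refine ho.abs_average_sub_average_le hb hM hR (by positivity)
        (closedBall_subset_closedBall' (by linarith)) ?_
      refine (measure_mono (closedBall_subset_closedBall' (ε₂ := 2 ^ 2 * R) (y := y) ?_)).trans ?_
      · rw [dist_comm]; linarith
      · push_cast; exact hD.measure_le_pow y hR 2
    have e2 : |m - ⨍ z in closedBall x (2 * R), b z ∂μ| ≤ D * M :=
      ho.abs_average_sub_average_le hb hM hR (by positivity)
        (closedBall_subset_closedBall (by linarith)) (hD.2 x R hR)
    have e3 := abs_sub_le (⨍ z in closedBall y R, b z ∂μ) (⨍ z in closedBall x (2 * R), b z ∂μ) m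
    rw [abs_sub_comm (⨍ z in closedBall x (2 * R), b z ∂μ) m] at e3
    push_cast at e1
    have e4 : (D : ℝ) ^ 2 * M + D * M ≤ A * M := by
      rw [← add_mul]
      exact mul_le_mul_of_nonneg_right (by nlinarith) hM
    linarith
  obtain ⟨j, hj⟩ : ∃ j, Nat.find hex = j + 1 :=
    Nat.exists_eq_succ_of_ne_zero fun h => h0 ((Nat.find_eq_zero hex).1 h)
  have hspec := Nat.find_spec hex
  have hmin := Nat.find_min hex (m := j) (by omega)
  rw [hj] at hspec
  have hpos : 0 < R / 2 ^ j := by positivity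
  refine ⟨R / 2 ^ (j + 1), by positivity, ?_, hspec, ?_⟩
  · gcongr
    exact le_self_pow₀ (by norm_num) (by omega)
  · have h4 : 4 * (R / 2 ^ (j + 1)) = 2 * (R / 2 ^ j) := by
      rw [pow_succ]; field_simp; norm_num
    rw [h4]
    have e1 : |(⨍ z in closedBall y (R / 2 ^ j), b z ∂μ)
        - ⨍ z in closedBall y (2 * (R / 2 ^ j)), b z ∂μ| ≤ D * M :=
      ho.abs_average_sub_average_le hb hM hpos (by positivity)
        (closedBall_subset_closedBall (by linarith)) (hD.2 y _ hpos)
    have e3 := abs_sub_le (⨍ z in closedBall y (2 * (R / 2 ^ j)), b z ∂μ)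
      (⨍ z in closedBall y (R / 2 ^ j), b z ∂μ) m
    rw [abs_sub_comm _ (⨍ z in closedBall y (R / 2 ^ j), b z ∂μ)] at e3
    linarith [not_lt.1 hmin]

lemma OscBound.lintegral_double_le (hb : LocallyIntegrable b μ) (hD : DoublingWith μ D)
    (hM : 0 ≤ M) (ho : OscBound μ b M) (x : X) {R : ℝ} (hR : 0 < R) :
    ∫⁻ y in closedBall x (2 * R), ENNReal.ofReal |b y - ⨍ z in closedBall x R, b z ∂μ| ∂μ
      ≤ ENNReal.ofReal (2 * D ^ 2 * M) * μ (closedBall x R) := by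
  set m := ⨍ z in closedBall x R, b z ∂μ with hm
  set m' := ⨍ z in closedBall x (2 * R), b z ∂μ with hm'
  have hD1 : (1 : ℝ) ≤ D := by exact_mod_cast hD.1
  have e2 : |m - m'| ≤ D * M :=
    ho.abs_average_sub_average_le hb hM hR (by positivity)
      (closedBall_subset_closedBall (by linarith)) (hD.2 x R hR)
  have hfin := measure_closedBall_ne_top (μ := μ) x (2 * R)
  have hbI : IntegrableOn b (closedBall x (2 * R)) μ :=
    hb.integrableOn_isCompact (isCompact_closedBall _ _)
  have hI (c : ℝ) : IntegrableOn (fun y => |b y - c|) (closedBall x (2 * R)) μ :=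
    (hbI.sub (integrableOn_const hfin)).abs
  have hreal : μ.real (closedBall x (2 * R)) ≤ D * μ.real (closedBall x R) :=
    measureReal_le_mul_of_le (measure_closedBall_ne_top x R) (hD.2 x R hR)
  rw [← ofReal_integral_eq_lintegral_ofReal (hI m)
    (Filter.Eventually.of_forall fun _ => abs_nonneg _),
    ← ofReal_measureReal (measure_closedBall_ne_top x R),
    ← ENNReal.ofReal_mul (by positivity)]
  refine ENNReal.ofReal_le_ofReal ?_
  calc ∫ y in closedBall x (2 * R), |b y - m| ∂μ
      ≤ ∫ y in closedBall x (2 * R), (|b y - m'| + D * M) ∂μ := by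
        refine integral_mono (hI m) ((hI m').add (integrableOn_const hfin)) fun y => ?_
        have := abs_sub_le (b y) m' m
        rw [abs_sub_comm m' m] at this
        dsimp only
        linarith
    _ = (∫ y in closedBall x (2 * R), |b y - m'| ∂μ)
        + D * M * μ.real (closedBall x (2 * R)) := by
        rw [integral_add (hI m') (integrableOn_const hfin), setIntegral_const, smul_eq_mul,
          mul_comm (μ.real _)]
    _ ≤ M * μ.real (closedBall x (2 * R)) + D * M * μ.real (closedBall x (2 * R)) :=
        add_le_add (ho x _ (by positivity)) le_rfl
    _ ≤ (2 * D * M) * μ.real (closedBall x (2 * R)) := by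
        rw [← add_mul]
        refine mul_le_mul_of_nonneg_right ?_ measureReal_nonneg
        nlinarith
    _ ≤ (2 * D * M) * (D * μ.real (closedBall x R)) := by gcongr
    _ = 2 * D ^ 2 * M * μ.real (closedBall x R) := by ring

/-- **John–Nirenberg inequality**: exponential decay of the deviation sets. -/
lemma OscBound.measure_deviationSet_le (hb : LocallyIntegrable b μ) (hD : DoublingWith μ D)
    (hM : 0 < M) (ho : OscBound μ b M) (k : ℕ) :
    ∀ (x : X) (R : ℝ), 0 < R →
      μ (deviationSet μ b x R (k * ((4 * (D : ℝ) ^ 4 + D) * M)))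
        ≤ (2⁻¹ : ℝ≥0∞) ^ k * μ (closedBall x R) := by
  have := hD.isUnifLocDoublingMeasure
  have hD1 : (1 : ℝ) ≤ D := by exact_mod_cast hD.1
  induction k with
  | zero =>
    intro x R _
    exact (measure_mono (Set.sep_subset _ _)).trans (by simp)
  | succ k ih =>
    intro x R hR
    set m := ⨍ z in closedBall x R, b z ∂μ with hm
    set A : ℝ := 4 * (D : ℝ) ^ 4 with hA
    set t : ℝ := ((k + 1 : ℕ) : ℝ) * ((A + D) * M) with ht
    have hA0 : 0 < A := by positivity
    have hAM : 0 < A * M := by positivity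
    have hADM : A * M < (A + D) * M := mul_lt_mul_of_pos_right (by linarith) hM
    have hAt : A * M < t := by
      have : (1 : ℝ) ≤ ((k + 1 : ℕ) : ℝ) := by push_cast; linarith [k.cast_nonneg (α := ℝ)]
      nlinarith
    have hA2 : 2 * (D : ℝ) ^ 2 ≤ A := by
      have : (D : ℝ) ^ 2 ≤ (D : ℝ) ^ 4 := pow_le_pow_right₀ hD1 (by norm_num)
      rw [hA]; nlinarith [sq_nonneg (D : ℝ)]
    have hleb : ∀ᵐ y ∂μ, Filter.Tendsto (fun j : ℕ => ⨍ z in closedBall y (R / 2 ^ j), b z ∂μ)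
        Filter.atTop (nhds (b y)) := by
      filter_upwards [IsUnifLocDoublingMeasure.ae_tendsto_average μ hb 1] with y hy
      refine hy (fun _ => y) (fun j : ℕ => R / 2 ^ j) ?_ ?_
      · refine tendsto_nhdsWithin_iff.2 ⟨?_, Filter.Eventually.of_forall fun j => ?_⟩
        · have := (tendsto_pow_atTop_nhds_zero_of_lt_one (r := (2⁻¹ : ℝ)) (by norm_num)
            (by norm_num)).const_mul R
          simpa [div_eq_mul_inv] using this
        · show 0 < R / 2 ^ j
          positivity
      · exact Filter.Eventually.of_forall fun j => mem_closedBall_self (by positivity)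
    set T : Set X := deviationSet μ b x R t ∩ {y | Filter.Tendsto
      (fun j : ℕ => ⨍ z in closedBall y (R / 2 ^ j), b z ∂μ) Filter.atTop (nhds (b y))} with hT
    have hTmeas : μ (deviationSet μ b x R t) = μ T :=
      (measure_inter_conull (mem_ae_iff.1 hleb)).symm
    have hex : ∀ y : X, ∃ ρ : ℝ, y ∈ T → 0 < ρ ∧ ρ ≤ R / 2 ∧
        A * M < |(⨍ z in closedBall y ρ, b z ∂μ) - m| ∧
        |(⨍ z in closedBall y (4 * ρ), b z ∂μ) - m| ≤ (A + D) * M := by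
      intro y
      by_cases hy : y ∈ T
      · obtain ⟨ρ, hρ⟩ := ho.exists_stopping_radius hb hD hM.le hR hA2 hy.1.1 hy.2 hAt hy.1.2
        exact ⟨ρ, fun _ => hρ⟩
      · exact ⟨0, fun h => absurd h hy⟩
    choose ρ hρ using hex
    obtain ⟨U, hUT, hdisj, hcov⟩ := Vitali.exists_disjoint_subfamily_covering_enlargement_closedBall
      T (fun y => y) ρ (R / 2) (fun y hy => (hρ y hy).2.1) 4 (by norm_num)
    have hUc : U.Countable := hdisj.countable_of_nonempty_interior fun y hy =>
      ⟨y, ball_subset_interior_closedBall (mem_ball_self (hρ y (hUT hy)).1)⟩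
    have hTsub : T ⊆ ⋃ y ∈ U, deviationSet μ b y (4 * ρ y) (k * ((A + D) * M)) := by
      intro z hz
      obtain ⟨y, hyU, hy⟩ := hcov z hz
      have hzy : z ∈ closedBall y (4 * ρ y) := hy (mem_closedBall_self (hρ z hz).1.le)
      refine Set.mem_biUnion hyU ⟨hzy, ?_⟩
      have h1 := (hρ y (hUT hyU)).2.2.2
      have h2 : t ≤ |b z - m| := hz.1.2
      have h3 := abs_sub_le (b z) (⨍ z in closedBall y (4 * ρ y), b z ∂μ) m
      rw [ht] at h2
      push_cast at h2
      linarith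
    have hball (y : X) (hy : y ∈ U) : ENNReal.ofReal (A * M) * μ (closedBall y (ρ y)) ≤
        ∫⁻ z in closedBall y (ρ y), ENNReal.ofReal |b z - m| ∂μ := by
      have hpos := (hρ y (hUT hy)).1
      have hfin := measure_closedBall_ne_top (μ := μ) y (ρ y)
      have hμ0 := (measure_closedBall_pos μ y hpos).ne'
      have hI : IntegrableOn (fun z => b z - m) (closedBall y (ρ y)) μ :=
        (hb.integrableOn_isCompact (isCompact_closedBall _ _)).sub (integrableOn_const hfin)
      rw [← ofReal_integral_eq_lintegral_ofReal hI.abs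
        (Filter.Eventually.of_forall fun _ => abs_nonneg _), ← ofReal_measureReal hfin,
        ← ENNReal.ofReal_mul hAM.le]
      refine ENNReal.ofReal_le_ofReal ?_
      by_contra! hlt
      have hreal : 0 < μ.real (closedBall y (ρ y)) := ENNReal.toReal_pos hμ0 hfin
      have := abs_setAverage_sub_le (K := 1) (c := m) (subset_refl (closedBall y (ρ y))) hμ0 hfin
        (hb.integrableOn_isCompact (isCompact_closedBall _ _)) hAM.le (by simp) hlt.le
      linarith [(hρ y (hUT hy)).2.2.1]
    have hsum : ENNReal.ofReal (A * M) * ∑' y : U, μ (closedBall (y : X) (ρ y)) ≤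
        ENNReal.ofReal (2 * D ^ 2 * M) * μ (closedBall x R) := by
      rw [← ENNReal.tsum_mul_left]
      calc ∑' y : U, ENNReal.ofReal (A * M) * μ (closedBall (y : X) (ρ y))
          ≤ ∑' y : U, ∫⁻ z in closedBall (y : X) (ρ y), ENNReal.ofReal |b z - m| ∂μ :=
            ENNReal.tsum_le_tsum fun y => hball y y.2
        _ = ∫⁻ z in ⋃ y ∈ U, closedBall y (ρ y), ENNReal.ofReal |b z - m| ∂μ :=
            (lintegral_biUnion hUc (fun _ _ => isClosed_closedBall.measurableSet) hdisj _).symm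
        _ ≤ ∫⁻ z in closedBall x (2 * R), ENNReal.ofReal |b z - m| ∂μ := by
            refine lintegral_mono_set (Set.iUnion₂_subset fun y hy => ?_)
            refine closedBall_subset_closedBall' ?_
            have h1 := (hρ y (hUT hy)).2.1
            have h2 : dist y x ≤ R := (hUT hy).1.1
            linarith
        _ ≤ _ := ho.lintegral_double_le hb hD hM.le x hR
    have hsum' : (D : ℝ≥0∞) ^ 2 * ∑' y : U, μ (closedBall (y : X) (ρ y)) ≤
        2⁻¹ * μ (closedBall x R) := by
      have hc : ENNReal.ofReal (A * M) = (2 * ENNReal.ofReal (2 * D ^ 2 * M)) * (D : ℝ≥0∞) ^ 2 := by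
        rw [← ENNReal.ofReal_coe_nnreal, ← ENNReal.ofReal_pow (by positivity),
          ← ENNReal.ofReal_ofNat 2, ← ENNReal.ofReal_mul (by positivity),
          ← ENNReal.ofReal_mul (by positivity), hA]
        congr 1; ring
      have hne0 : ENNReal.ofReal (2 * D ^ 2 * M) ≠ 0 := by
        rw [Ne, ENNReal.ofReal_eq_zero, not_le]; positivity
      rw [hc, mul_assoc, mul_assoc, mul_left_comm,
        ENNReal.mul_le_mul_iff_right hne0 ENNReal.ofReal_ne_top] at hsum
      rw [mul_comm (2⁻¹ : ℝ≥0∞), ← div_eq_mul_inv, ENNReal.le_div_iff_mul_le (by simp) (by simp),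
        mul_comm]
      exact hsum
    calc μ (deviationSet μ b x R t) = μ T := hTmeas
      _ ≤ μ (⋃ y ∈ U, deviationSet μ b y (4 * ρ y) (k * ((A + D) * M))) := measure_mono hTsub
      _ ≤ ∑' y : U, μ (deviationSet μ b y (4 * ρ y) (k * ((A + D) * M))) :=
          measure_biUnion_le _ hUc _
      _ ≤ ∑' y : U, 2⁻¹ ^ k * ((D : ℝ≥0∞) ^ 2 * μ (closedBall (y : X) (ρ y))) := by
          refine ENNReal.tsum_le_tsum fun y => ?_
          have hpos := (hρ y (hUT y.2)).1
          refine (ih y (4 * ρ y) (by positivity)).trans ?_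
          gcongr
          have := hD.measure_le_pow (y : X) hpos 2
          norm_num at this ⊢
          exact this
      _ = 2⁻¹ ^ k * ((D : ℝ≥0∞) ^ 2 * ∑' y : U, μ (closedBall (y : X) (ρ y))) := by
          rw [ENNReal.tsum_mul_left, ENNReal.tsum_mul_left]
      _ ≤ 2⁻¹ ^ k * (2⁻¹ * μ (closedBall x R)) := by gcongr
      _ = 2⁻¹ ^ (k + 1) * μ (closedBall x R) := by ring

lemma summable_add_three_rpow_mul_geometric (u : ℝ) :
    Summable fun k : ℕ => ((k : ℝ) + 3) ^ u * (2⁻¹ : ℝ) ^ k := by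
  obtain ⟨n, hn⟩ := exists_nat_ge u
  have h := ((summable_nat_add_iff 3).2
    (summable_pow_mul_geometric_of_norm_lt_one (R := ℝ) n (r := 2⁻¹) (by norm_num))).mul_left 8
  refine h.of_nonneg_of_le (fun k => by positivity) fun k => ?_
  have h1 : ((k : ℝ) + 3) ^ u ≤ ((k : ℝ) + 3) ^ n := by
    rw [← Real.rpow_natCast]
    exact Real.rpow_le_rpow_of_exponent_le (by linarith [k.cast_nonneg (α := ℝ)]) hn
  calc ((k : ℝ) + 3) ^ u * (2⁻¹ : ℝ) ^ k ≤ ((k : ℝ) + 3) ^ n * (2⁻¹ : ℝ) ^ k := by gcongr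
    _ = 8 * (((k + 3 : ℕ) : ℝ) ^ n * 2⁻¹ ^ (k + 3)) := by push_cast; rw [pow_add]; ring

/-- The sum `∑ (k + 3) ^ u / 2 ^ k`. -/
def rpowGeometricSum (u : ℝ) : ℝ := ∑' k : ℕ, ((k : ℝ) + 3) ^ u * (2⁻¹ : ℝ) ^ k

lemma rpowGeometricSum_nonneg (u : ℝ) : 0 ≤ rpowGeometricSum u :=
  tsum_nonneg fun _ => by positivity

lemma tsum_ofReal_rpow_mul_geometric (u c : ℝ) (hc : 0 ≤ c) :
    ∑' k : ℕ, ENNReal.ofReal (c * (((k : ℝ) + 3) ^ u * (2⁻¹ : ℝ) ^ k))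
      = ENNReal.ofReal (c * rpowGeometricSum u) := by
  rw [rpowGeometricSum, ← tsum_mul_left, ENNReal.ofReal_tsum_of_nonneg]
  · exact fun k => by positivity
  · exact (summable_add_three_rpow_mul_geometric u).mul_left c

/-- The `L^u` form of the John–Nirenberg inequality. -/
lemma OscBound.lintegral_rpow_le (hb : LocallyIntegrable b μ) (hD : DoublingWith μ D)
    (hM : 0 < M) (ho : OscBound μ b M) {u : ℝ} (hu : 0 < u) (x : X) {R : ℝ} (hR : 0 < R) :
    ∫⁻ y in closedBall x R, ENNReal.ofReal (|b y - ⨍ z in closedBall x R, b z ∂μ| ^ u) ∂μ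
      ≤ ENNReal.ofReal (((4 * (D : ℝ) ^ 4 + D) * M) ^ u * rpowGeometricSum u)
        * μ (closedBall x R) := by
  set m := ⨍ z in closedBall x R, b z ∂μ with hm
  have hD1 : (1 : ℝ) ≤ D := by exact_mod_cast hD.1
  set L : ℝ := (4 * (D : ℝ) ^ 4 + D) * M with hL
  have hL0 : 0 < L := by positivity
  set S : ℕ → Set X := fun k => toMeasurable μ (deviationSet μ b x R (k * L)) with hS
  have hSm (k : ℕ) : MeasurableSet (S k) := measurableSet_toMeasurable _ _
  have hpt : ∀ y ∈ closedBall x R, ENNReal.ofReal (|b y - m| ^ u) ≤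
      ∑' k : ℕ, (S k).indicator (fun _ => ENNReal.ofReal ((((k : ℝ) + 3) * L) ^ u)) y := by
    intro y hy
    set k := ⌊|b y - m| / L⌋₊ with hk
    have h0 : 0 ≤ |b y - m| / L := by positivity
    have h1 : (k : ℝ) * L ≤ |b y - m| := (le_div_iff₀ hL0).1 (Nat.floor_le h0)
    have h2 : |b y - m| ≤ ((k : ℝ) + 3) * L := by
      have := (div_lt_iff₀ hL0).1 (Nat.lt_floor_add_one (|b y - m| / L))
      rw [← hk] at this
      linarith
    have hmem : y ∈ S k := subset_toMeasurable _ _ ⟨hy, h1⟩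
    refine le_trans ?_ (ENNReal.le_tsum k)
    rw [Set.indicator_of_mem hmem]
    exact ENNReal.ofReal_le_ofReal (Real.rpow_le_rpow (abs_nonneg _) h2 hu.le)
  calc ∫⁻ y in closedBall x R, ENNReal.ofReal (|b y - m| ^ u) ∂μ
      ≤ ∫⁻ y in closedBall x R,
          ∑' k : ℕ, (S k).indicator (fun _ => ENNReal.ofReal ((((k : ℝ) + 3) * L) ^ u)) y ∂μ :=
        setLIntegral_mono' isClosed_closedBall.measurableSet hpt
    _ ≤ ∫⁻ y, ∑' k : ℕ,
          (S k).indicator (fun _ => ENNReal.ofReal ((((k : ℝ) + 3) * L) ^ u)) y ∂μ :=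
        setLIntegral_le_lintegral _ _
    _ = ∑' k : ℕ, ENNReal.ofReal ((((k : ℝ) + 3) * L) ^ u)
          * μ (deviationSet μ b x R (k * L)) := by
        rw [lintegral_tsum fun k => (measurable_const.indicator (hSm k)).aemeasurable]
        refine tsum_congr fun k => ?_
        rw [lintegral_indicator_const (hSm k), measure_toMeasurable]
    _ ≤ ∑' k : ℕ, ENNReal.ofReal (L ^ u * (((k : ℝ) + 3) ^ u * (2⁻¹ : ℝ) ^ k))
          * μ (closedBall x R) := by
        refine ENNReal.tsum_le_tsum fun k => ?_
        calc _ ≤ ENNReal.ofReal ((((k : ℝ) + 3) * L) ^ u)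
              * ((2⁻¹ : ℝ≥0∞) ^ k * μ (closedBall x R)) := by
              gcongr
              exact ho.measure_deviationSet_le hb hD hM k x R hR
          _ = _ := by
              rw [← mul_assoc]
              congr 1
              have : (2⁻¹ : ℝ≥0∞) ^ k = ENNReal.ofReal ((2⁻¹ : ℝ) ^ k) := by
                rw [ENNReal.ofReal_pow (by norm_num), ENNReal.ofReal_inv_of_pos (by norm_num),
                  ENNReal.ofReal_ofNat]
              rw [this, ← ENNReal.ofReal_mul (by positivity),
                Real.mul_rpow (by positivity) hL0.le]
              congr 1; ring
    _ = _ := by rw [ENNReal.tsum_mul_right, tsum_ofReal_rpow_mul_geometric _ _ (by positivity)]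

end Doubling

section DunklMeasure

variable {Rs : Finset (EuclideanSpace ℝ (Fin N))} {κ : EuclideanSpace ℝ (Fin N) → ℝ}

lemma norm_le_two_of_root (hnorm : ∀ α ∈ Rs, ⟪α, α⟫ = (2 : ℝ)) {α : EuclideanSpace ℝ (Fin N)}
    (hα : α ∈ Rs) : ‖α‖ ≤ 2 := by
  have h := hnorm α hα
  rw [real_inner_self_eq_norm_sq] at h
  nlinarith [norm_nonneg α]

lemma abs_inner_sub_le (hnorm : ∀ α ∈ Rs, ⟪α, α⟫ = (2 : ℝ)) {α : EuclideanSpace ℝ (Fin N)}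
    (hα : α ∈ Rs) {x y : EuclideanSpace ℝ (Fin N)} {r : ℝ} (hy : y ∈ closedBall x r) :
    |⟪α, y⟫ - ⟪α, x⟫| ≤ 2 * r := by
  rw [← inner_sub_right]
  refine (abs_real_inner_le_norm _ _).trans ?_
  rw [mem_closedBall, dist_eq_norm] at hy
  exact mul_le_mul (norm_le_two_of_root hnorm hα) hy (norm_nonneg _) (by norm_num)

lemma exists_vector_off_root_hyperplanes (hnorm : ∀ α ∈ Rs, ⟪α, α⟫ = (2 : ℝ)) :
    ∃ (v : EuclideanSpace ℝ (Fin N)) (δ : ℝ), 0 < δ ∧ δ ≤ 1 ∧ ‖v‖ ≤ 1 ∧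
      ∀ α ∈ Rs, δ ≤ |⟪α, v⟫| := by
  obtain ⟨v, hv⟩ := Module.Dual.exists_forall_ne_zero_of_forall_exists
    (fun α : Rs => (innerSL ℝ (α : EuclideanSpace ℝ (Fin N))).toLinearMap) fun α =>
      ⟨α, by simp only [ContinuousLinearMap.coe_coe, innerSL_apply_apply]
             rw [hnorm α α.2]; norm_num⟩
  simp only [ContinuousLinearMap.coe_coe, innerSL_apply_apply] at hv
  set w : EuclideanSpace ℝ (Fin N) := (1 + ‖v‖)⁻¹ • v with hw
  have hpos : 0 < 1 + ‖v‖ := by positivity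
  have hw1 : ‖w‖ ≤ 1 := by
    rw [hw, norm_smul, norm_inv, Real.norm_of_nonneg hpos.le, inv_mul_le_iff₀ hpos]
    linarith
  have hwα : ∀ α ∈ Rs, 0 < |⟪α, w⟫| := fun α hα => by
    rw [hw, inner_smul_right, abs_pos]
    exact mul_ne_zero (inv_pos.2 hpos).ne' (hv ⟨α, hα⟩)
  rcases Rs.eq_empty_or_nonempty with h | h
  · exact ⟨w, 1, one_pos, le_rfl, hw1, by simp [h]⟩
  · obtain ⟨β, hβ, hmin⟩ := Rs.exists_min_image (fun α => |⟪α, w⟫|) h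
    exact ⟨w, min |⟪β, w⟫| 1, lt_min (hwα β hβ) one_pos, min_le_right _ _, hw1,
      fun α hα => (min_le_left _ _).trans (hmin α hα)⟩

/-- Every ball contains a point at distance comparable to the radius from all root hyperplanes. -/
lemma exists_point_far_from_root_hyperplanes (hnorm : ∀ α ∈ Rs, ⟪α, α⟫ = (2 : ℝ)) :
    ∃ ε : ℝ, 0 < ε ∧ ε ≤ 1 ∧ ∀ (x : EuclideanSpace ℝ (Fin N)) (r : ℝ), 0 < r →
      ∃ z ∈ closedBall x (r / 2), ∀ α ∈ Rs, ε * r ≤ |⟪α, z⟫| := by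
  obtain ⟨v, δ, hδ, hδ1, hv1, hv⟩ := exists_vector_off_root_hyperplanes hnorm
  set n := Rs.card with hn
  have hn1 : (1 : ℝ) ≤ n + 1 := by linarith [n.cast_nonneg (α := ℝ)]
  refine ⟨δ / (4 * (n + 1)), by positivity, (div_le_one (by positivity)).2 (by linarith), ?_⟩
  intro x r hr
  set s : ℝ := r / (2 * (n + 1)) with hs
  have hs0 : 0 < s := by positivity
  by_contra! hcon
  have hbad : ∀ j ∈ Finset.range (n + 1), ∃ α ∈ Rs,
      |⟪α, x + ((j : ℝ) * s) • v⟫| < δ / (4 * (n + 1)) * r := by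
    intro j hj
    refine hcon _ ?_
    rw [mem_closedBall, dist_eq_norm, add_sub_cancel_left, norm_smul,
      Real.norm_of_nonneg (by positivity)]
    have hjn : (j : ℝ) ≤ n + 1 := by exact_mod_cast (Finset.mem_range.1 hj).le
    calc (j : ℝ) * s * ‖v‖ ≤ (n + 1) * s * 1 := by gcongr
      _ = r / 2 := by rw [hs]; field_simp
  choose! f hf hflt using hbad
  obtain ⟨i, hi, j, hj, hij, hfij⟩ := Finset.exists_ne_map_eq_of_card_lt_of_maps_to
    (s := Finset.range (n + 1)) (t := Rs) (f := f) (by simp [hn]) hf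
  have h1 := hflt i hi
  have h2 := hflt j hj
  rw [← hfij] at h2
  have h3 := hv (f i) (hf i hi)
  have h4 : ⟪f i, x + ((i : ℝ) * s) • v⟫ - ⟪f i, x + ((j : ℝ) * s) • v⟫
      = ((i : ℝ) - j) * (s * ⟪f i, v⟫) := by
    rw [← inner_sub_right, add_sub_add_left_eq_sub, ← sub_smul, inner_smul_right]; ring
  have h5 := abs_sub (⟪f i, x + ((i : ℝ) * s) • v⟫) (⟪f i, x + ((j : ℝ) * s) • v⟫)
  have h6 : (1 : ℝ) ≤ |(i : ℝ) - j| := by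
    have : (1 : ℤ) ≤ |(i : ℤ) - j| := Int.one_le_abs (sub_ne_zero.2 (by exact_mod_cast hij))
    exact_mod_cast this
  rw [h4, abs_mul, abs_mul, abs_of_pos hs0] at h5
  have h7 : δ / (4 * (n + 1)) * r = s * δ / 2 := by rw [hs]; field_simp; ring
  have h8 : s * δ ≤ |(i : ℝ) - j| * (s * |⟪f i, v⟫|) := by
    calc s * δ ≤ 1 * (s * |⟪f i, v⟫|) := by rw [one_mul]; gcongr
      _ ≤ _ := by gcongr
  linarith

/-- Every ball contains a comparable ball on which the root functionals are as large as they get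
on the doubled ball, up to a constant factor. -/
lemma exists_subball_root_lower_bound (hnorm : ∀ α ∈ Rs, ⟪α, α⟫ = (2 : ℝ)) :
    ∃ η θ : ℝ, 0 < η ∧ 0 < θ ∧ ∀ (x : EuclideanSpace ℝ (Fin N)) (r : ℝ), 0 < r →
      ∃ z, closedBall z (η * r) ⊆ closedBall x r ∧
        ∀ α ∈ Rs, ∀ y ∈ closedBall z (η * r), θ * (|⟪α, x⟫| + 4 * r) ≤ |⟪α, y⟫| := by
  obtain ⟨ε, hε, hε1, h⟩ := exists_point_far_from_root_hyperplanes hnorm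
  refine ⟨ε / 4, (1 + 12 / ε)⁻¹, by positivity, by positivity, fun x r hr => ?_⟩
  obtain ⟨z, hz, hzα⟩ := h x r hr
  have hsub : closedBall z (ε / 4 * r) ⊆ closedBall x r :=
    closedBall_subset_closedBall' (by have : dist z x ≤ r / 2 := hz; nlinarith)
  refine ⟨z, hsub, fun α hα y hy => ?_⟩
  have h1 := hzα α hα
  have h2 := abs_inner_sub_le hnorm hα hy
  have h3 := abs_inner_sub_le hnorm hα (hsub hy)
  have h4 : ε * r / 2 ≤ |⟪α, y⟫| := by
    have := abs_sub_abs_le_abs_sub ⟪α, z⟫ ⟪α, y⟫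
    rw [abs_sub_comm] at this
    linarith
  have h5 : |⟪α, x⟫| - 2 * r ≤ |⟪α, y⟫| := by
    have := abs_sub_abs_le_abs_sub ⟪α, x⟫ ⟪α, y⟫
    rw [abs_sub_comm] at this
    linarith
  have h6 : r ≤ 2 / ε * |⟪α, y⟫| := by
    rw [div_mul_eq_mul_div, le_div_iff₀ hε]; linarith
  rw [inv_mul_le_iff₀ (by positivity), add_mul, one_mul]
  have h7 : 12 / ε * |⟪α, y⟫| = 6 * (2 / ε * |⟪α, y⟫|) := by ring
  linarith

lemma dunklWeight_nonneg (x : EuclideanSpace ℝ (Fin N)) : 0 ≤ dunklWeight Rs κ x :=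
  Finset.prod_nonneg fun _ _ => Real.rpow_nonneg (abs_nonneg _) _

lemma continuous_dunklWeight (hκ0 : ∀ α ∈ Rs, 0 ≤ κ α) : Continuous (dunklWeight Rs κ) := by
  unfold dunklWeight
  refine continuous_finsetProd _ fun α hα => ?_
  exact Continuous.rpow_const (by fun_prop) fun _ => Or.inr (hκ0 α hα)

lemma isLocallyFiniteMeasure_dunklMeasure (hκ0 : ∀ α ∈ Rs, 0 ≤ κ α) :
    IsLocallyFiniteMeasure (dunklMeasure Rs κ) :=
  IsLocallyFiniteMeasure.withDensity_ofReal (continuous_dunklWeight hκ0)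

lemma dunklMeasure_le_of_weight_le {E : Set (EuclideanSpace ℝ (Fin N))} (hE : MeasurableSet E)
    {W : ℝ} (h : ∀ y ∈ E, dunklWeight Rs κ y ≤ W) :
    dunklMeasure Rs κ E ≤ ENNReal.ofReal W * volume E := by
  rw [dunklMeasure, withDensity_apply _ hE, ← setLIntegral_const]
  exact setLIntegral_mono' hE fun y hy => ENNReal.ofReal_le_ofReal (h y hy)

lemma le_dunklMeasure_of_le_weight {E : Set (EuclideanSpace ℝ (Fin N))} (hE : MeasurableSet E)
    {W : ℝ} (h : ∀ y ∈ E, W ≤ dunklWeight Rs κ y) :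
    ENNReal.ofReal W * volume E ≤ dunklMeasure Rs κ E := by
  rw [dunklMeasure, withDensity_apply _ hE, ← setLIntegral_const]
  exact setLIntegral_mono' hE fun y hy => ENNReal.ofReal_le_ofReal (h y hy)

/-- Two-sided comparison of the Dunkl measure of balls with an explicit expression. -/
lemma exists_dunklMeasure_closedBall_bounds (hnorm : ∀ α ∈ Rs, ⟪α, α⟫ = (2 : ℝ))
    (hκ0 : ∀ α ∈ Rs, 0 ≤ κ α) :
    ∃ D : ℝ, 0 < D ∧ ∀ (x : EuclideanSpace ℝ (Fin N)) (r : ℝ), 0 < r → ∃ V : ℝ, 0 < V ∧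
      dunklMeasure Rs κ (closedBall x (2 * r)) ≤ ENNReal.ofReal (D * V) ∧
      ENNReal.ofReal V ≤ dunklMeasure Rs κ (closedBall x r) := by
  obtain ⟨η, θ, hη, hθ, h⟩ := exists_subball_root_lower_bound hnorm
  set Θ : ℝ := ∏ α ∈ Rs, θ ^ κ α with hΘ
  have hΘ0 : 0 < Θ := Finset.prod_pos fun _ _ => Real.rpow_pos_of_pos hθ _
  set v : ℝ := volume.real (ball (0 : EuclideanSpace ℝ (Fin N)) 1) with hv
  have hvt : volume (ball (0 : EuclideanSpace ℝ (Fin N)) 1) = ENNReal.ofReal v :=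
    (ofReal_measureReal measure_ball_lt_top.ne).symm
  have hv0 : 0 < v :=
    ENNReal.toReal_pos (measure_ball_pos volume _ one_pos).ne' measure_ball_lt_top.ne
  set n := Module.finrank ℝ (EuclideanSpace ℝ (Fin N))
  have hvol (z : EuclideanSpace ℝ (Fin N)) (s : ℝ) (hs : 0 ≤ s) :
      volume (closedBall z s) = ENNReal.ofReal (s ^ n * v) := by
    rw [Measure.addHaar_closedBall _ _ hs, hvt, ENNReal.ofReal_mul (by positivity)]
  refine ⟨(2 / η) ^ n / Θ, by positivity, fun x r hr => ?_⟩
  obtain ⟨z, hzsub, hz⟩ := h x r hr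
  set W : ℝ := ∏ α ∈ Rs, (|⟪α, x⟫| + 4 * r) ^ κ α with hW
  have hW0 : 0 < W := Finset.prod_pos fun _ _ => Real.rpow_pos_of_pos (by positivity) _
  refine ⟨Θ * W * ((η * r) ^ n * v), by positivity, ?_, ?_⟩
  · refine (dunklMeasure_le_of_weight_le isClosed_closedBall.measurableSet (W := W)
      fun y hy => ?_).trans ?_
    · refine Finset.prod_le_prod (fun _ _ => Real.rpow_nonneg (abs_nonneg _) _) fun α hα => ?_
      refine Real.rpow_le_rpow (abs_nonneg _) ?_ (hκ0 α hα)
      have h1 := abs_inner_sub_le hnorm hα hy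
      have h2 := abs_sub_abs_le_abs_sub ⟪α, y⟫ ⟪α, x⟫
      linarith
    · rw [hvol _ _ (by positivity), ← ENNReal.ofReal_mul hW0.le]
      refine ENNReal.ofReal_le_ofReal (le_of_eq ?_)
      rw [mul_pow, mul_pow, div_pow]
      field_simp
  · refine le_trans ?_ (measure_mono hzsub)
    rw [ENNReal.ofReal_mul (by positivity), ← hvol z _ (by positivity)]
    refine le_dunklMeasure_of_le_weight isClosed_closedBall.measurableSet fun y hy => ?_
    rw [hΘ, hW, ← Finset.prod_mul_distrib]
    refine Finset.prod_le_prod (fun _ _ => by positivity) fun α hα => ?_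
    rw [← Real.mul_rpow hθ.le (by positivity)]
    exact Real.rpow_le_rpow (by positivity) (hz α hα y hy) (hκ0 α hα)

lemma exists_doublingWith_dunklMeasure (hnorm : ∀ α ∈ Rs, ⟪α, α⟫ = (2 : ℝ))
    (hκ0 : ∀ α ∈ Rs, 0 ≤ κ α) : ∃ D : ℝ≥0, DoublingWith (dunklMeasure Rs κ) D := by
  obtain ⟨D, hD, h⟩ := exists_dunklMeasure_closedBall_bounds hnorm hκ0
  refine ⟨max 1 D.toNNReal, le_max_left _ _, fun x r hr => ?_⟩
  obtain ⟨V, -, h1, h2⟩ := h x r hr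
  calc dunklMeasure Rs κ (closedBall x (2 * r)) ≤ ENNReal.ofReal (D * V) := h1
    _ = ENNReal.ofReal D * ENNReal.ofReal V := ENNReal.ofReal_mul hD.le
    _ ≤ ((max 1 D.toNNReal : ℝ≥0) : ℝ≥0∞) * dunklMeasure Rs κ (closedBall x r) := by
        gcongr
        exact ENNReal.coe_le_coe.2 (le_max_right _ _)

lemma isOpenPosMeasure_dunklMeasure (hnorm : ∀ α ∈ Rs, ⟪α, α⟫ = (2 : ℝ))
    (hκ0 : ∀ α ∈ Rs, 0 ≤ κ α) : (dunklMeasure Rs κ).IsOpenPosMeasure := by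
  obtain ⟨D, -, h⟩ := exists_dunklMeasure_closedBall_bounds hnorm hκ0
  refine ⟨fun U hU ⟨x, hx⟩ => ?_⟩
  obtain ⟨r, hr, hsub⟩ := Metric.nhds_basis_closedBall.mem_iff.1 (hU.mem_nhds hx)
  obtain ⟨V, hV, -, h2⟩ := h x r hr
  exact ((ENNReal.ofReal_pos.2 hV).trans_le (h2.trans (measure_mono hsub))).ne'

end DunklMeasure

section Invariance

variable {Rs : Finset (EuclideanSpace ℝ (Fin N))} {κ : EuclideanSpace ℝ (Fin N) → ℝ}

lemma inner_dunklReflect_right (α β x : EuclideanSpace ℝ (Fin N)) :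
    ⟪β, dunklReflect α x⟫ = ⟪dunklReflect α β, x⟫ := by
  simp only [dunklReflect, inner_sub_left, inner_sub_right, inner_smul_left, inner_smul_right,
    RCLike.conj_to_real, real_inner_comm α β]
  ring

lemma dunklReflect_dunklReflect {α : EuclideanSpace ℝ (Fin N)} (hα : ⟪α, α⟫ = (2 : ℝ))
    (x : EuclideanSpace ℝ (Fin N)) : dunklReflect α (dunklReflect α x) = x := by
  simp only [dunklReflect, inner_sub_right, inner_smul_right, hα]
  module

lemma dunklWeight_dunklReflect (hnorm : ∀ α ∈ Rs, ⟪α, α⟫ = (2 : ℝ))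
    (hRinv : ∀ α ∈ Rs, ∀ β ∈ Rs, dunklReflect α β ∈ Rs)
    (hκinv : ∀ α ∈ Rs, ∀ β ∈ Rs, κ (dunklReflect α β) = κ β)
    {α : EuclideanSpace ℝ (Fin N)} (hα : α ∈ Rs) (x : EuclideanSpace ℝ (Fin N)) :
    dunklWeight Rs κ (dunklReflect α x) = dunklWeight Rs κ x := by
  refine Finset.prod_nbij' (dunklReflect α) (dunklReflect α) (hRinv α hα) (hRinv α hα)
    (fun β _ => dunklReflect_dunklReflect (hnorm α hα) β)
    (fun β _ => dunklReflect_dunklReflect (hnorm α hα) β) fun β hβ => ?_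
  rw [inner_dunklReflect_right, hκinv α hα β hβ]

lemma dunklWeight_apply_of_mem_dunklGroup (hnorm : ∀ α ∈ Rs, ⟪α, α⟫ = (2 : ℝ))
    (hRinv : ∀ α ∈ Rs, ∀ β ∈ Rs, dunklReflect α β ∈ Rs)
    (hκinv : ∀ α ∈ Rs, ∀ β ∈ Rs, κ (dunklReflect α β) = κ β)
    {σ : EuclideanSpace ℝ (Fin N) ≃ₗᵢ[ℝ] EuclideanSpace ℝ (Fin N)} (hσ : σ ∈ dunklGroup Rs) :
    ∀ x, dunklWeight Rs κ (σ x) = dunklWeight Rs κ x := by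
  induction hσ using Subgroup.closure_induction with
  | mem σ h =>
    obtain ⟨α, hα, h⟩ := h
    intro x
    rw [h, dunklWeight_dunklReflect hnorm hRinv hκinv hα]
  | one => intro x; rfl
  | mul σ τ _ _ h1 h2 => intro x; exact (h1 _).trans (h2 _)
  | inv σ _ h => intro x; rw [← h, LinearIsometryEquiv.inv_def, σ.apply_symm_apply]

/-- The measure of closed balls is invariant under the action of `dunklGroup Rs` on centers. -/
def BallInvariant (Rs : Finset (EuclideanSpace ℝ (Fin N)))
    (μ : Measure (EuclideanSpace ℝ (Fin N))) : Prop :=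
  ∀ σ ∈ dunklGroup Rs, ∀ (x : EuclideanSpace ℝ (Fin N)) (r : ℝ),
    μ (closedBall (σ x) r) = μ (closedBall x r)

lemma ballInvariant_dunklMeasure (hnorm : ∀ α ∈ Rs, ⟪α, α⟫ = (2 : ℝ))
    (hRinv : ∀ α ∈ Rs, ∀ β ∈ Rs, dunklReflect α β ∈ Rs)
    (hκ0 : ∀ α ∈ Rs, 0 ≤ κ α)
    (hκinv : ∀ α ∈ Rs, ∀ β ∈ Rs, κ (dunklReflect α β) = κ β) :
    BallInvariant Rs (dunklMeasure Rs κ) := by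
  intro σ hσ x r
  rw [dunklMeasure, withDensity_apply _ isClosed_closedBall.measurableSet,
    withDensity_apply _ isClosed_closedBall.measurableSet,
    ← σ.measurePreserving.setLIntegral_comp_preimage isClosed_closedBall.measurableSet
      (continuous_dunklWeight hκ0).measurable.ennreal_ofReal, σ.preimage_closedBall,
    σ.symm_apply_apply]
  simp_rw [dunklWeight_apply_of_mem_dunklGroup hnorm hRinv hκinv hσ]

end Invariance

section DunklBall

variable {Rs : Finset (EuclideanSpace ℝ (Fin N))} {x y : EuclideanSpace ℝ (Fin N)} {ρ ρ' : ℝ}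

lemma exists_norm_sub_lt_of_dunklDist_lt (h : dunklDist Rs x y < ρ) :
    ∃ σ : dunklGroup Rs, ‖x - σ.1 y‖ < ρ :=
  exists_lt_of_ciInf_lt h

lemma dunklBall_subset_iUnion : dunklBall Rs x ρ ⊆ ⋃ σ : dunklGroup Rs, closedBall (σ.1 x) ρ := by
  intro y hy
  obtain ⟨σ, hσ⟩ := exists_norm_sub_lt_of_dunklDist_lt hy
  refine Set.mem_iUnion.2 ⟨σ⁻¹, ?_⟩
  rw [mem_closedBall', ← σ.1.dist_map, dist_eq_norm]
  simpa [LinearIsometryEquiv.inv_def] using hσ.le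

variable [Finite (dunklGroup Rs)]

lemma dunklDist_le_norm_sub (σ : dunklGroup Rs) : dunklDist Rs x y ≤ ‖x - σ.1 y‖ :=
  ciInf_le (Set.finite_range _).bddBelow σ

lemma measurable_dunklDist : Measurable fun ξ => dunklDist Rs ξ x := by
  unfold dunklDist
  exact Measurable.iInf fun σ => by fun_prop

lemma closedBall_subset_dunklBall (σ : dunklGroup Rs) (h : ρ < ρ') :
    closedBall (σ.1 x) ρ ⊆ dunklBall Rs x ρ' := by
  intro y hy
  refine (dunklDist_le_norm_sub (σ⁻¹)).trans_lt (lt_of_le_of_lt ?_ h)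
  rw [mem_closedBall', ← (σ⁻¹).1.dist_map, dist_eq_norm] at hy
  simpa [LinearIsometryEquiv.inv_def] using hy

variable {μ : Measure (EuclideanSpace ℝ (Fin N))} {b : EuclideanSpace ℝ (Fin N) → ℝ}

lemma measure_dunklBall_le (hinv : BallInvariant Rs μ) :
    μ (dunklBall Rs x ρ) ≤ Nat.card (dunklGroup Rs) * μ (closedBall x ρ) := by
  have := Fintype.ofFinite (dunklGroup Rs)
  refine (measure_mono dunklBall_subset_iUnion).trans ((measure_iUnion_le _).trans ?_)
  simp_rw [hinv _ (Subtype.prop _) x ρ]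
  simp [tsum_fintype, Nat.card_eq_fintype_card]

lemma integrableOn_dunklBall (hb : LocallyIntegrable b μ) :
    IntegrableOn b (dunklBall Rs x ρ) μ :=
  (hb.integrableOn_isCompact (isCompact_iUnion fun _ => isCompact_closedBall _ _)).mono_set
    dunklBall_subset_iUnion

lemma measure_dunklBall_le_of_le (hinv : BallInvariant Rs μ) {D : ℝ≥0} (hD : DoublingWith μ D)
    (σ : dunklGroup Rs) {r : ℝ} (hr : 0 < r) {k : ℕ} (h : ρ = 2 ^ k * r) :
    μ (dunklBall Rs x ρ) ≤
      ((Nat.card (dunklGroup Rs) * D ^ k : ℝ≥0) : ℝ≥0∞) * μ (closedBall (σ.1 x) r) := by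
  refine (measure_dunklBall_le hinv).trans ?_
  push_cast
  rw [mul_assoc, ← hinv σ.1 σ.2 x ρ, h]
  gcongr
  exact hD.measure_le_pow _ hr k

lemma measure_dunklBall_ne_zero [μ.IsOpenPosMeasure] (hρ : 0 < ρ) : μ (dunklBall Rs x ρ) ≠ 0 := by
  refine ((measure_closedBall_pos μ x (half_pos hρ)).trans_le (measure_mono ?_)).ne'
  exact closedBall_subset_dunklBall (1 : dunklGroup Rs) (half_lt_self hρ)

variable [IsLocallyFiniteMeasure μ]

lemma measure_dunklBall_ne_top (hinv : BallInvariant Rs μ) : μ (dunklBall Rs x ρ) ≠ ∞ :=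
  ne_top_of_le_ne_top
    (ENNReal.mul_ne_top (ENNReal.natCast_ne_top _) (measure_closedBall_ne_top x ρ))
    (measure_dunklBall_le hinv)

variable [μ.IsOpenPosMeasure] {D : ℝ≥0} {M : ℝ}

lemma IsBMOdBound.setIntegral_le (hinv : BallInvariant Rs μ) (hM : IsBMOdBound Rs μ b M)
    (x : EuclideanSpace ℝ (Fin N)) (hρ : 0 < ρ) :
    ∫ y in dunklBall Rs x ρ, |b y - ⨍ z in dunklBall Rs x ρ, b z ∂μ| ∂μ
      ≤ M * μ.real (dunklBall Rs x ρ) := by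
  have h := hM x ρ hρ
  have hpos : 0 < μ.real (dunklBall Rs x ρ) :=
    ENNReal.toReal_pos (measure_dunklBall_ne_zero hρ) (measure_dunklBall_ne_top hinv)
  rw [setAverage_eq, smul_eq_mul, inv_mul_le_iff₀ hpos] at h
  linarith

lemma IsBMOdBound.abs_average_sub_average_le (hinv : BallInvariant Rs μ)
    (hb : LocallyIntegrable b μ) (hM0 : 0 ≤ M) (hM : IsBMOdBound Rs μ b M) (hρ : 0 < ρ)
    {E : Set (EuclideanSpace ℝ (Fin N))} (hE : μ E ≠ 0) (hsub : E ⊆ dunklBall Rs x ρ) {K : ℝ≥0}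
    (hK : μ (dunklBall Rs x ρ) ≤ K * μ E) :
    |(⨍ z in E, b z ∂μ) - ⨍ z in dunklBall Rs x ρ, b z ∂μ| ≤ K * M :=
  abs_setAverage_sub_le hsub hE (measure_dunklBall_ne_top hinv) (integrableOn_dunklBall hb) hM0
    (measureReal_le_mul_of_le
      (ne_top_of_le_ne_top (measure_dunklBall_ne_top hinv) (measure_mono hsub)) hK)
    (hM.setIntegral_le hinv x hρ)

/-- A function in `BMO_d` has bounded mean oscillation over Euclidean balls. -/
lemma IsBMOdBound.oscBound (hinv : BallInvariant Rs μ) (hD : DoublingWith μ D)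
    (hb : LocallyIntegrable b μ) (hM0 : 0 ≤ M) (hM : IsBMOdBound Rs μ b M) :
    OscBound μ b (2 * (Nat.card (dunklGroup Rs) * D) * M) := by
  intro x r hr
  set n := Nat.card (dunklGroup Rs)
  set m := ⨍ z in closedBall x r, b z ∂μ
  set m' := ⨍ z in dunklBall Rs x (2 * r), b z ∂μ
  have hfin := measure_closedBall_ne_top (μ := μ) x r
  have hsub : closedBall x r ⊆ dunklBall Rs x (2 * r) :=
    closedBall_subset_dunklBall (1 : dunklGroup Rs) (by linarith)
  have hle : μ (dunklBall Rs x (2 * r)) ≤ ((n * D : ℝ≥0) : ℝ≥0∞) * μ (closedBall x r) := by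
    have := measure_dunklBall_le_of_le (x := x) (ρ := 2 * r) hinv hD 1 hr (k := 1) (by ring)
    simpa using this
  have h1 : |m - m'| ≤ n * D * M := by
    have := hM.abs_average_sub_average_le hinv hb hM0 (by positivity)
      (measure_closedBall_pos μ x hr).ne' hsub hle
    simpa using this
  have hreal : μ.real (dunklBall Rs x (2 * r)) ≤ n * D * μ.real (closedBall x r) := by
    simpa using measureReal_le_mul_of_le hfin hle
  have hbF : IntegrableOn b (dunklBall Rs x (2 * r)) μ := integrableOn_dunklBall hb
  have hIF : IntegrableOn (fun y => |b y - m'|) (dunklBall Rs x (2 * r)) μ :=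
    (hbF.sub (integrableOn_const (measure_dunklBall_ne_top hinv))).abs
  have hI (c : ℝ) : IntegrableOn (fun y => |b y - c|) (closedBall x r) μ :=
    ((hbF.mono_set hsub).sub (integrableOn_const hfin)).abs
  calc ∫ y in closedBall x r, |b y - m| ∂μ
      ≤ ∫ y in closedBall x r, (|b y - m'| + n * D * M) ∂μ := by
        refine integral_mono (hI m) ((hI m').add (integrableOn_const hfin)) fun y => ?_
        have := abs_sub_le (b y) m' m
        rw [abs_sub_comm m' m] at this
        dsimp only
        linarith
    _ = (∫ y in closedBall x r, |b y - m'| ∂μ) + n * D * M * μ.real (closedBall x r) := by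
        rw [integral_add (hI m') (integrableOn_const hfin), setIntegral_const, smul_eq_mul,
          mul_comm (μ.real _)]
    _ ≤ (∫ y in dunklBall Rs x (2 * r), |b y - m'| ∂μ) + n * D * M * μ.real (closedBall x r) := by
        refine add_le_add (setIntegral_mono_set hIF
          (Filter.Eventually.of_forall fun _ => abs_nonneg _) hsub.eventuallyLE) le_rfl
    _ ≤ M * (n * D * μ.real (closedBall x r)) + n * D * M * μ.real (closedBall x r) := by
        gcongr
        exact (hM.setIntegral_le hinv x (by positivity)).trans (by gcongr)
    _ = 2 * (n * D) * M * μ.real (closedBall x r) := by ring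

/-- The averages over concentric Dunkl balls grow at most linearly in the number of doublings. -/
lemma IsBMOdBound.abs_average_sub_dyadic_le (hinv : BallInvariant Rs μ) (hD : DoublingWith μ D)
    (hb : LocallyIntegrable b μ) (hM0 : 0 ≤ M) (hM : IsBMOdBound Rs μ b M)
    {r : ℝ} (hr : 0 < r) (k : ℕ) :
    |(⨍ z in dunklBall Rs x (2 ^ k * r), b z ∂μ) - ⨍ z in dunklBall Rs x r, b z ∂μ|
      ≤ k * (Nat.card (dunklGroup Rs) * D ^ 2 * M) := by
  induction k with
  | zero => simp
  | succ k ih =>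
    set n := Nat.card (dunklGroup Rs)
    have hpos : 0 < 2 ^ k * r := by positivity
    have h1 : |(⨍ z in dunklBall Rs x (2 ^ k * r), b z ∂μ)
        - ⨍ z in dunklBall Rs x (2 ^ (k + 1) * r), b z ∂μ| ≤ ((n * D ^ 2 : ℝ≥0) : ℝ) * M := by
      refine hM.abs_average_sub_average_le hinv hb hM0 (by positivity)
        (measure_dunklBall_ne_zero hpos) (fun y hy => ?_) ?_
      · have hy' : dunklDist Rs x y < 2 ^ k * r := hy
        have : dunklDist Rs x y < 2 ^ (k + 1) * r := by rw [pow_succ]; linarith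
        exact this
      · refine (measure_dunklBall_le_of_le hinv hD 1 (half_pos hpos) (k := 2)
          (by rw [pow_succ]; ring)).trans ?_
        gcongr
        exact closedBall_subset_dunklBall 1 (half_lt_self hpos)
    have h2 := abs_sub_le (⨍ z in dunklBall Rs x (2 ^ (k + 1) * r), b z ∂μ)
      (⨍ z in dunklBall Rs x (2 ^ k * r), b z ∂μ) (⨍ z in dunklBall Rs x r, b z ∂μ)
    rw [abs_sub_comm (⨍ z in dunklBall Rs x (2 ^ (k + 1) * r), b z ∂μ)
      (⨍ z in dunklBall Rs x (2 ^ k * r), b z ∂μ)] at h2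
    push_cast at h1 ⊢
    linarith

lemma ofReal_abs_sub_rpow_le {u : ℝ} (hu : 1 < u) (a m c : ℝ) {q : ℝ} (h : |m - c| ≤ q) :
    ENNReal.ofReal (|a - c| ^ u) ≤
      ENNReal.ofReal (2 ^ u) * ENNReal.ofReal (|a - m| ^ u)
        + ENNReal.ofReal (2 ^ u * q ^ u) := by
  have hq : 0 ≤ q := (abs_nonneg _).trans h
  rw [← ENNReal.ofReal_mul (by positivity), ← ENNReal.ofReal_add (by positivity) (by positivity)]
  refine ENNReal.ofReal_le_ofReal ?_
  calc |a - c| ^ u ≤ (|a - m| + q) ^ u := by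
        refine Real.rpow_le_rpow (abs_nonneg _) ?_ (by linarith)
        linarith [abs_sub_le a m c]
    _ ≤ 2 ^ (u - 1) * (|a - m| ^ u + q ^ u) :=
        NNReal.coe_le_coe.2 (NNReal.rpow_add_le_mul_rpow_add_rpow ⟨|a - m|, abs_nonneg _⟩ ⟨q, hq⟩
          hu.le)
    _ ≤ 2 ^ u * (|a - m| ^ u + q ^ u) := by
        gcongr
        · norm_num
        · linarith
    _ = _ := by ring

/-- The constant in the bound for the `L^u` deviation over balls of a fixed dyadic size, where
`n` is the order of the group and `D` the doubling constant. -/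
def deviationConst (n D u : ℝ) : ℝ :=
  2 ^ u * (((4 * D ^ 4 + D) * (2 * (n * D))) ^ u * rpowGeometricSum u + (n * D ^ 2) ^ u)

lemma deviationConst_nonneg {n D : ℝ} (hn : 0 ≤ n) (hD : 0 ≤ D) (u : ℝ) :
    0 ≤ deviationConst n D u := by
  have := rpowGeometricSum_nonneg u
  unfold deviationConst
  positivity

lemma IsBMOdBound.lintegral_closedBall_rpow_le (hinv : BallInvariant Rs μ)
    (hD : DoublingWith μ D) (hb : LocallyIntegrable b μ) (hM0 : 0 < M) (hM : IsBMOdBound Rs μ b M)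
    {u : ℝ} (hu : 1 < u) {r : ℝ} (hr : 0 < r) (k : ℕ) (σ : dunklGroup Rs) :
    ∫⁻ ξ in closedBall (σ.1 x) (2 ^ (k + 1) * r),
        ENNReal.ofReal (|b ξ - ⨍ z in dunklBall Rs x r, b z ∂μ| ^ u) ∂μ
      ≤ ENNReal.ofReal (deviationConst (Nat.card (dunklGroup Rs)) D u * M ^ u * ((k : ℝ) + 3) ^ u)
        * μ (closedBall x (2 ^ (k + 1) * r)) := by
  set n := Nat.card (dunklGroup Rs) with hn
  have hn1 : (1 : ℝ) ≤ n := by exact_mod_cast Nat.card_pos (α := dunklGroup Rs)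
  have hD1 : (1 : ℝ) ≤ D := by exact_mod_cast hD.1
  have hpos : 0 < 2 ^ (k + 1) * r := by positivity
  set B := closedBall (σ.1 x) (2 ^ (k + 1) * r) with hB
  set m := ⨍ z in B, b z ∂μ with hm
  set c := ⨍ z in dunklBall Rs x r, b z ∂μ with hc
  set S := rpowGeometricSum u with hS
  have hS0 : 0 ≤ S := rpowGeometricSum_nonneg u
  have hμB : μ B = μ (closedBall x (2 ^ (k + 1) * r)) := hinv σ.1 σ.2 x _
  have hmc : |m - c| ≤ ((k : ℝ) + 3) * (n * D ^ 2 * M) := by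
    have h1 : |m - ⨍ z in dunklBall Rs x (2 ^ (k + 2) * r), b z ∂μ| ≤
        ((n * D ^ 1 : ℝ≥0) : ℝ) * M := by
      refine hM.abs_average_sub_average_le hinv hb hM0.le (by positivity)
        (measure_closedBall_pos μ _ hpos).ne'
        (closedBall_subset_dunklBall σ ?_)
        (measure_dunklBall_le_of_le hinv hD σ hpos (k := 1) (by ring))
      rw [pow_succ _ (k + 1)]; linarith
    have h2 := hM.abs_average_sub_dyadic_le (x := x) hinv hD hb hM0.le hr (k + 2)
    have h3 := abs_sub_le m (⨍ z in dunklBall Rs x (2 ^ (k + 2) * r), b z ∂μ) c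
    have h4 : (n : ℝ) * D * M ≤ n * D ^ 2 * M := by
      gcongr; nlinarith
    push_cast at h1 h2
    rw [pow_one] at h1
    linarith
  have hJN := (hM.oscBound hinv hD hb hM0.le).lintegral_rpow_le hb hD (by positivity)
    (by linarith : 0 < u) (σ.1 x) hpos
  calc ∫⁻ ξ in B, ENNReal.ofReal (|b ξ - c| ^ u) ∂μ
      ≤ ∫⁻ ξ in B, (ENNReal.ofReal (2 ^ u) * ENNReal.ofReal (|b ξ - m| ^ u)
          + ENNReal.ofReal (2 ^ u * (((k : ℝ) + 3) * (n * D ^ 2 * M)) ^ u)) ∂μ :=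
        lintegral_mono fun ξ => ofReal_abs_sub_rpow_le hu _ _ _ hmc
    _ = ENNReal.ofReal (2 ^ u) * (∫⁻ ξ in B, ENNReal.ofReal (|b ξ - m| ^ u) ∂μ)
          + ENNReal.ofReal (2 ^ u * (((k : ℝ) + 3) * (n * D ^ 2 * M)) ^ u) * μ B := by
        rw [lintegral_add_right _ measurable_const, setLIntegral_const,
          lintegral_const_mul' _ _ ENNReal.ofReal_ne_top]
    _ ≤ ENNReal.ofReal (2 ^ u) * (ENNReal.ofReal
          (((4 * (D : ℝ) ^ 4 + D) * (2 * (n * D) * M)) ^ u * S) * μ B)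
          + ENNReal.ofReal (2 ^ u * (((k : ℝ) + 3) * (n * D ^ 2 * M)) ^ u) * μ B := by
        gcongr
    _ = ENNReal.ofReal (2 ^ u * (((4 * (D : ℝ) ^ 4 + D) * (2 * (n * D) * M)) ^ u * S)
          + 2 ^ u * (((k : ℝ) + 3) * (n * D ^ 2 * M)) ^ u) * μ B := by
        rw [← mul_assoc, ← add_mul, ← ENNReal.ofReal_mul (by positivity),
          ← ENNReal.ofReal_add (by positivity) (by positivity)]
    _ ≤ _ := by
        rw [hμB]
        gcongr
        have hk1 : (1 : ℝ) ≤ ((k : ℝ) + 3) ^ u :=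
          Real.one_le_rpow (by linarith [k.cast_nonneg (α := ℝ)]) (by linarith)
        rw [← mul_assoc (4 * (D : ℝ) ^ 4 + D), Real.mul_rpow (by positivity) hM0.le,
          Real.mul_rpow (x := (k : ℝ) + 3) (by positivity) (by positivity),
          Real.mul_rpow (x := (n : ℝ) * D ^ 2) (by positivity) hM0.le]
        rw [deviationConst, ← hS]
        set P := ((4 * (D : ℝ) ^ 4 + D) * (2 * (n * D))) ^ u with hP
        have hP0 : 0 ≤ P := by positivity
        have h5 : 2 ^ u * (P * M ^ u * S) * 1 ≤ 2 ^ u * (P * M ^ u * S) * ((k : ℝ) + 3) ^ u :=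
          mul_le_mul_of_nonneg_left hk1 (by positivity)
        linarith

/-- The part of the tail integral over a dyadic annulus. -/
lemma IsBMOdBound.lintegral_annulus_le (hinv : BallInvariant Rs μ)
    (hD : DoublingWith μ D) (hb : LocallyIntegrable b μ) (hM0 : 0 < M) (hM : IsBMOdBound Rs μ b M)
    {u : ℝ} (hu : 1 < u) {r : ℝ} (hr : 0 < r) (k : ℕ) :
    ∫⁻ ξ in {ξ | 2 ^ k * r ≤ dunklDist Rs ξ x ∧ dunklDist Rs ξ x < 2 ^ (k + 1) * r},
        (ENNReal.ofReal (dunklDist Rs ξ x) * μ (ball ξ (dunklDist Rs ξ x)))⁻¹ *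
          ENNReal.ofReal (|b ξ - ⨍ z in dunklBall Rs x r, b z ∂μ| ^ u) ∂μ
      ≤ ENNReal.ofReal (Nat.card (dunklGroup Rs) * D ^ 3
          * deviationConst (Nat.card (dunklGroup Rs)) D u / r * M ^ u
          * (((k : ℝ) + 3) ^ u * 2⁻¹ ^ k)) := by
  have := Fintype.ofFinite (dunklGroup Rs)
  set n := Nat.card (dunklGroup Rs) with hn
  have hD1 : (1 : ℝ) ≤ D := by exact_mod_cast hD.1
  set c := ⨍ z in dunklBall Rs x r, b z ∂μ with hc
  set A := {ξ | 2 ^ k * r ≤ dunklDist Rs ξ x ∧ dunklDist Rs ξ x < 2 ^ (k + 1) * r} with hA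
  set K := deviationConst n D u with hK
  have hK0 : 0 ≤ K := deviationConst_nonneg (by positivity) (by positivity) u
  have hs : 0 < 2 ^ k * r := by positivity
  set V := μ.real (closedBall x (2 ^ (k + 1) * r)) with hV
  have hVt : μ (closedBall x (2 ^ (k + 1) * r)) = ENNReal.ofReal V :=
    (ofReal_measureReal (measure_closedBall_ne_top x _)).symm
  have hV0 : 0 < V := ENNReal.toReal_pos (measure_closedBall_pos μ x (by positivity)).ne'
    (measure_closedBall_ne_top x _)
  have hAm : MeasurableSet A :=
    (measurableSet_le measurable_const measurable_dunklDist).inter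
      (measurableSet_lt measurable_dunklDist measurable_const)
  have hAsub : A ⊆ ⋃ σ : dunklGroup Rs, closedBall (σ.1 x) (2 ^ (k + 1) * r) := by
    rintro ξ ⟨-, hξ⟩
    obtain ⟨σ, hσ⟩ := exists_norm_sub_lt_of_dunklDist_lt hξ
    exact Set.mem_iUnion.2 ⟨σ, by rw [mem_closedBall, dist_eq_norm]; exact hσ.le⟩
  have hker : ∀ ξ ∈ A, (ENNReal.ofReal (dunklDist Rs ξ x) * μ (ball ξ (dunklDist Rs ξ x)))⁻¹
      ≤ ENNReal.ofReal (D ^ 3 / (2 ^ k * r * V)) := by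
    rintro ξ ⟨hξ1, hξ2⟩
    obtain ⟨σ, hσ⟩ := exists_norm_sub_lt_of_dunklDist_lt hξ2
    have h1 : ENNReal.ofReal V ≤ ENNReal.ofReal (D ^ 3) * μ (ball ξ (dunklDist Rs ξ x)) := by
      calc ENNReal.ofReal V = μ (closedBall (σ.1 x) (2 ^ (k + 1) * r)) := by
            rw [hinv σ.1 σ.2 x, hVt]
        _ ≤ μ (closedBall ξ (2 ^ 3 * (2 ^ k * r / 2))) := by
            refine measure_mono (closedBall_subset_closedBall' ?_)
            rw [dist_comm, dist_eq_norm]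
            rw [pow_succ] at hσ ⊢
            linarith
        _ ≤ (D : ℝ≥0∞) ^ 3 * μ (closedBall ξ (2 ^ k * r / 2)) :=
            hD.measure_le_pow ξ (half_pos hs) 3
        _ ≤ ENNReal.ofReal (D ^ 3) * μ (ball ξ (dunklDist Rs ξ x)) := by
            rw [ENNReal.ofReal_pow (by positivity), ENNReal.ofReal_coe_nnreal]
            gcongr
            exact closedBall_subset_ball (by linarith)
    have h2 : ENNReal.ofReal (V / D ^ 3) ≤ μ (ball ξ (dunklDist Rs ξ x)) := by
      rw [ENNReal.ofReal_div_of_pos (by positivity)]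
      exact ENNReal.div_le_of_le_mul' h1
    have h3 : (D : ℝ) ^ 3 / (2 ^ k * r * V) = (2 ^ k * r * (V / D ^ 3))⁻¹ := by
      field_simp
    rw [h3, ENNReal.ofReal_inv_of_pos (by positivity), ENNReal.inv_le_inv,
      ENNReal.ofReal_mul hs.le]
    gcongr
  calc _ ≤ ∫⁻ ξ in A, ENNReal.ofReal (D ^ 3 / (2 ^ k * r * V))
          * ENNReal.ofReal (|b ξ - c| ^ u) ∂μ :=
        setLIntegral_mono' hAm fun ξ hξ => by gcongr; exact hker ξ hξ
    _ = ENNReal.ofReal (D ^ 3 / (2 ^ k * r * V))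
          * ∫⁻ ξ in A, ENNReal.ofReal (|b ξ - c| ^ u) ∂μ :=
        lintegral_const_mul' _ _ ENNReal.ofReal_ne_top
    _ ≤ ENNReal.ofReal (D ^ 3 / (2 ^ k * r * V))
          * ∑ σ : dunklGroup Rs, ∫⁻ ξ in closedBall (σ.1 x) (2 ^ (k + 1) * r),
              ENNReal.ofReal (|b ξ - c| ^ u) ∂μ := by
        gcongr
        rw [← tsum_fintype (L := .unconditional _)]
        exact (lintegral_mono_set hAsub).trans (lintegral_iUnion_le _ _)
    _ ≤ ENNReal.ofReal (D ^ 3 / (2 ^ k * r * V))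
          * ∑ _σ : dunklGroup Rs, ENNReal.ofReal (K * M ^ u * ((k : ℝ) + 3) ^ u)
            * ENNReal.ofReal V := by
        gcongr with σ
        rw [← hVt]
        exact hM.lintegral_closedBall_rpow_le hinv hD hb hM0 hu hr k σ
    _ = _ := by
        rw [Finset.sum_const, Finset.card_univ, ← Nat.card_eq_fintype_card, ← hn, nsmul_eq_mul,
          ← ENNReal.ofReal_natCast, ← ENNReal.ofReal_mul (by positivity),
          ← ENNReal.ofReal_mul (by positivity), ← ENNReal.ofReal_mul (by positivity)]
        congr 1
        rw [inv_pow]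
        field_simp

/-- The tail integral estimate for an arbitrary positive bound of the mean oscillation. -/
lemma IsBMOdBound.lintegral_tail_le (hinv : BallInvariant Rs μ)
    (hD : DoublingWith μ D) (hb : LocallyIntegrable b μ) (hM0 : 0 < M) (hM : IsBMOdBound Rs μ b M)
    {u : ℝ} (hu : 1 < u) {r : ℝ} (hr : 0 < r) :
    ∫⁻ ξ in {ξ | 5 * r ≤ dunklDist Rs ξ x},
        (ENNReal.ofReal (dunklDist Rs ξ x) * μ (ball ξ (dunklDist Rs ξ x)))⁻¹ *
          ENNReal.ofReal (|b ξ - ⨍ z in dunklBall Rs x r, b z ∂μ| ^ u) ∂μ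
      ≤ ENNReal.ofReal (Nat.card (dunklGroup Rs) * D ^ 3
          * deviationConst (Nat.card (dunklGroup Rs)) D u / r * M ^ u * rpowGeometricSum u) := by
  have hK0 := deviationConst_nonneg (Nat.card (dunklGroup Rs)).cast_nonneg D.coe_nonneg u
  have hsub : {ξ | 5 * r ≤ dunklDist Rs ξ x} ⊆ ⋃ k : ℕ,
      {ξ | 2 ^ k * r ≤ dunklDist Rs ξ x ∧ dunklDist Rs ξ x < 2 ^ (k + 1) * r} := by
    intro ξ (hξ : 5 * r ≤ dunklDist Rs ξ x)
    obtain ⟨k, hk1, hk2⟩ := exists_nat_pow_near (x := dunklDist Rs ξ x / r) (y := 2)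
      ((one_le_div hr).2 (by linarith)) (by norm_num)
    exact Set.mem_iUnion.2 ⟨k, (le_div_iff₀ hr).1 hk1, (div_lt_iff₀ hr).1 hk2⟩
  refine (lintegral_mono_set hsub).trans ((lintegral_iUnion_le _ _).trans ?_)
  rw [← tsum_ofReal_rpow_mul_geometric _ _ (by positivity)]
  exact ENNReal.tsum_le_tsum fun k => hM.lintegral_annulus_le hinv hD hb hM0 hu hr k

end DunklBall

lemma isBMOdBound_of_bmodNorm_lt {Rs : Finset (EuclideanSpace ℝ (Fin N))}
    {μ : Measure (EuclideanSpace ℝ (Fin N))} {b : EuclideanSpace ℝ (Fin N) → ℝ}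
    (hb : MemBMOd Rs μ b) {M : ℝ} (hM : bmodNorm Rs μ b < M) : IsBMOdBound Rs μ b M := by
  obtain ⟨M₀, hM₀⟩ := hb.2
  have hne : {M | 0 ≤ M ∧ IsBMOdBound Rs μ b M}.Nonempty :=
    ⟨max M₀ 0, le_max_right _ _, fun x r hr => (hM₀ x r hr).trans (le_max_left _ _)⟩
  obtain ⟨M', ⟨-, hM'⟩, hlt⟩ := exists_lt_of_csInf_lt hne hM
  exact fun x r hr => (hM' x r hr).trans hlt.le

lemma bmodNorm_nonneg (Rs : Finset (EuclideanSpace ℝ (Fin N)))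
    (μ : Measure (EuclideanSpace ℝ (Fin N))) (b : EuclideanSpace ℝ (Fin N) → ℝ) :
    0 ≤ bmodNorm Rs μ b :=
  Real.sInf_nonneg fun _ h => h.1

/-- ∫_{d(ξ,x₀) ≥ 5r} (d(ξ,x₀) ω(B(ξ,d(ξ,x₀))))⁻¹ |b(ξ) - b_{O(B(x₀,r))}|^u dω(ξ)
    ≤ C r⁻¹ ‖b‖_{BMO_d}^u. -/
theorem dunkl_bmod_tail_integral
    (Rs : Finset (EuclideanSpace ℝ (Fin N))) (κ : EuclideanSpace ℝ (Fin N) → ℝ)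
    (hN : 1 ≤ N)
    (hnorm : ∀ α ∈ Rs, ⟪α, α⟫ = (2 : ℝ))
    (hRinv : ∀ α ∈ Rs, ∀ β ∈ Rs, dunklReflect α β ∈ Rs)
    (hκ0 : ∀ α ∈ Rs, 0 ≤ κ α)
    (hκinv : ∀ α ∈ Rs, ∀ β ∈ Rs, κ (dunklReflect α β) = κ β)
    (hGfin : Finite (dunklGroup Rs))
    (u : ℝ) (hu : 1 < u) :
    ∃ C : ℝ, 0 < C ∧ ∀ b : EuclideanSpace ℝ (Fin N) → ℝ,
      MemBMOd Rs (dunklMeasure Rs κ) b →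
      ∀ (x₀ : EuclideanSpace ℝ (Fin N)) (r : ℝ), 0 < r →
      ∫⁻ ξ in {ξ | 5 * r ≤ dunklDist Rs ξ x₀},
          (ENNReal.ofReal (dunklDist Rs ξ x₀) *
              dunklMeasure Rs κ (ball ξ (dunklDist Rs ξ x₀)))⁻¹ *
            ENNReal.ofReal
              (|b ξ - ⨍ z in dunklBall Rs x₀ r, b z ∂(dunklMeasure Rs κ)| ^ u)
          ∂(dunklMeasure Rs κ)
        ≤ ENNReal.ofReal (C / r * bmodNorm Rs (dunklMeasure Rs κ) b ^ u) := by
  have := isLocallyFiniteMeasure_dunklMeasure hκ0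
  have := isOpenPosMeasure_dunklMeasure hnorm hκ0
  have hinv := ballInvariant_dunklMeasure hnorm hRinv hκ0 hκinv
  obtain ⟨D, hD⟩ := exists_doublingWith_dunklMeasure hnorm hκ0
  set K : ℝ := Nat.card (dunklGroup Rs) * D ^ 3
    * deviationConst (Nat.card (dunklGroup Rs)) D u * rpowGeometricSum u with hK
  have hK0 : 0 ≤ K := by
    have := deviationConst_nonneg (Nat.card (dunklGroup Rs)).cast_nonneg D.coe_nonneg u
    have := rpowGeometricSum_nonneg u
    positivity
  refine ⟨K + 1, by positivity, fun b hb x₀ r hr => ?_⟩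
  set ν := bmodNorm Rs (dunklMeasure Rs κ) b with hν
  have hν0 : 0 ≤ ν := bmodNorm_nonneg _ _ _
  have hcont : Filter.Tendsto (fun M : ℝ => ENNReal.ofReal ((K + 1) / r * M ^ u))
      (nhdsWithin ν (Set.Ioi ν)) (nhds (ENNReal.ofReal ((K + 1) / r * ν ^ u))) :=
    ENNReal.tendsto_ofReal (((Real.continuousAt_rpow_const ν u
      (Or.inr (by linarith))).tendsto.mono_left nhdsWithin_le_nhds).const_mul _)
  refine ge_of_tendsto hcont ?_
  filter_upwards [self_mem_nhdsWithin] with M hM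
  have hM0 : 0 < M := hν0.trans_lt hM
  refine ((isBMOdBound_of_bmodNorm_lt hb hM).lintegral_tail_le hinv hD hb.1 hM0 hu hr).trans ?_
  refine ENNReal.ofReal_le_ofReal ?_
  have h1 : (Nat.card (dunklGroup Rs) : ℝ) * D ^ 3
      * deviationConst (Nat.card (dunklGroup Rs)) D u / r * M ^ u * rpowGeometricSum u
      = K / r * M ^ u := by rw [hK]; ring
  rw [h1]
  gcongr
  linarith
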